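/- Let l > 0 and let f : ℝ → ℂ be continuously differentiable on the interval [0, l]. Then for every δ with 0 < δ ≤ l one has |f(0)|² ≤ (2/δ) ∫₀^l |f(x)|² dx + 2δ ∫₀^l |f'(x)|² dx. -/

import Mathlib

open MeasureTheory

/-- Cauchy–Schwarz inequality on `[0, δ]` against the constant function `1`. -/
lemma sq_intervalIntegral_le_mul_intervalIntegral_sq {g : ℝ → ℝ} {δ : ℝ} (hδ : 0 < δ)
    (hg : ContinuousOn g (Set.Icc 0 δ)) :
    (∫ x in (0:ℝ)..δ, g x) ^ 2 ≤ δ * ∫ x in (0:ℝ)..δ, g x ^ 2 := by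
  have h1 : IntervalIntegrable g volume 0 δ := hg.intervalIntegrable_of_Icc hδ.le
  have h2 : IntervalIntegrable (fun x ↦ g x ^ 2) volume 0 δ :=
    (hg.pow 2).intervalIntegrable_of_Icc hδ.le
  set A := ∫ x in (0:ℝ)..δ, g x with hA
  have key : 0 ≤ ∫ x in (0:ℝ)..δ, (δ * g x - A) ^ 2 :=
    intervalIntegral.integral_nonneg hδ.le fun x _ ↦ sq_nonneg _
  have expand : ∫ x in (0:ℝ)..δ, (δ * g x - A) ^ 2
      = δ ^ 2 * (∫ x in (0:ℝ)..δ, g x ^ 2) - 2 * δ * A * A + δ * A ^ 2 := by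
    have : ∀ x, (δ * g x - A) ^ 2 = δ ^ 2 * g x ^ 2 - 2 * δ * A * g x + A ^ 2 :=
      fun x ↦ by ring
    simp_rw [this]
    rw [intervalIntegral.integral_add ((h2.const_mul _).sub (h1.const_mul _)) (by simp),
      intervalIntegral.integral_sub (h2.const_mul _) (h1.const_mul _),
      intervalIntegral.integral_const_mul, intervalIntegral.integral_const_mul]
    simp [← hA]
  rw [expand] at key
  refine le_of_mul_le_mul_left ?_ hδ
  nlinarith

/-- The trace estimate on `[0, δ]`, for a function with a derivative on the open interval
that extends continuously to the closed one. -/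
lemma norm_sq_le_integral_norm_sq_add_integral_norm_deriv_sq
    {E : Type*} [NormedAddCommGroup E] [NormedSpace ℝ E] [CompleteSpace E]
    {f f' : ℝ → E} {δ : ℝ} (hδ : 0 < δ) (hf : ContinuousOn f (Set.Icc 0 δ))
    (hf' : ContinuousOn f' (Set.Icc 0 δ))
    (hderiv : ∀ x ∈ Set.Ioo 0 δ, HasDerivAt f (f' x) x) :
    ‖f 0‖ ^ 2 ≤ (2 / δ) * (∫ x in (0:ℝ)..δ, ‖f x‖ ^ 2)
      + 2 * δ * (∫ x in (0:ℝ)..δ, ‖f' x‖ ^ 2) := by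
  have hcs := sq_intervalIntegral_le_mul_intervalIntegral_sq hδ hf'.norm
  set B := ∫ x in (0:ℝ)..δ, ‖f' x‖ ^ 2
  have pointwise : ∀ t ∈ Set.Icc 0 δ, ‖f 0‖ ^ 2 ≤ 2 * ‖f t‖ ^ 2 + 2 * (δ * B) := by
    intro t ht
    have hsub : Set.Icc 0 t ⊆ Set.Icc 0 δ := Set.Icc_subset_Icc_right ht.2
    have ftc : ∫ x in (0:ℝ)..t, f' x = f t - f 0 :=
      intervalIntegral.integral_eq_sub_of_hasDerivAt_of_le ht.1 (hf.mono hsub)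
        (fun x hx ↦ hderiv x ⟨hx.1, hx.2.trans_le ht.2⟩)
        ((hf'.mono hsub).intervalIntegrable_of_Icc ht.1)
    have hle : ‖f t - f 0‖ ≤ ∫ x in (0:ℝ)..δ, ‖f' x‖ := by
      rw [← ftc]
      refine (intervalIntegral.norm_integral_le_integral_norm ht.1).trans ?_
      exact intervalIntegral.integral_mono_interval le_rfl ht.1 ht.2
        (Filter.Eventually.of_forall fun x ↦ norm_nonneg _)
        (hf'.norm.intervalIntegrable_of_Icc hδ.le)
    have htri : ‖f 0‖ ≤ ‖f t‖ + ‖f t - f 0‖ := by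
      simpa using norm_sub_le (f t) (f t - f 0)
    have hsq : ‖f t - f 0‖ ^ 2 ≤ δ * B := (pow_le_pow_left₀ (norm_nonneg _) hle 2).trans hcs
    nlinarith [pow_le_pow_left₀ (norm_nonneg _) htri 2, sq_nonneg (‖f t‖ - ‖f t - f 0‖)]
  have hfi : IntervalIntegrable (fun x ↦ ‖f x‖ ^ 2) volume 0 δ :=
    (hf.norm.pow 2).intervalIntegrable_of_Icc hδ.le
  have averaged := intervalIntegral.integral_mono_on hδ.le (by simp)
    ((hfi.const_mul 2).add (by simp)) pointwise
  rw [intervalIntegral.integral_add (hfi.const_mul 2) (by simp),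
    intervalIntegral.integral_const_mul] at averaged
  simp only [intervalIntegral.integral_const, sub_zero, smul_eq_mul] at averaged
  refine le_of_mul_le_mul_left (averaged.trans_eq ?_) hδ
  field_simp

/-- One-dimensional trace estimate: for `f` continuously differentiable on `[0, l]`
and `0 < δ ≤ l`, the boundary value `|f(0)|²` is controlled by the `L²`-norms of
`f` and `f'`. -/
theorem boundary_value_trace_estimate (l : ℝ) (hl : 0 < l) (f : ℝ → ℂ)
    (hf : ContDiffOn ℝ 1 f (Set.Icc 0 l)) (δ : ℝ) (hδ : 0 < δ) (hδl : δ ≤ l) :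
    ‖f 0‖ ^ 2 ≤ (2 / δ) * (∫ x in (0:ℝ)..l, ‖f x‖ ^ 2)
      + 2 * δ * (∫ x in (0:ℝ)..l, ‖deriv f x‖ ^ 2) := by
  have hf' : ContinuousOn (derivWithin f (Set.Icc 0 l)) (Set.Icc 0 l) :=
    hf.continuousOn_derivWithin (uniqueDiffOn_Icc hl) le_rfl
  have hsub : Set.Icc 0 δ ⊆ Set.Icc 0 l := Set.Icc_subset_Icc_right hδl
  have hderiv : ∀ x ∈ Set.Ioo 0 l, HasDerivAt f (derivWithin f (Set.Icc 0 l) x) x :=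
    fun x hx ↦ ((hf.differentiableOn one_ne_zero x
      (Set.Ioo_subset_Icc_self hx)).hasDerivWithinAt).hasDerivAt (Icc_mem_nhds hx.1 hx.2)
  have hint : ∫ x in (0:ℝ)..l, ‖deriv f x‖ ^ 2
      = ∫ x in (0:ℝ)..l, ‖derivWithin f (Set.Icc 0 l) x‖ ^ 2 := by
    simp only [intervalIntegral.integral_of_le hl.le, integral_Ioc_eq_integral_Ioo]
    exact setIntegral_congr_fun measurableSet_Ioo fun x hx ↦ by
      simp only [(hderiv x hx).deriv]
  have extend : ∀ {g : ℝ → ℂ}, ContinuousOn g (Set.Icc 0 l) →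
      ∫ x in (0:ℝ)..δ, ‖g x‖ ^ 2 ≤ ∫ x in (0:ℝ)..l, ‖g x‖ ^ 2 := fun hg ↦
    intervalIntegral.integral_mono_interval le_rfl hδ.le hδl
      (Filter.Eventually.of_forall fun x ↦ sq_nonneg _)
      ((hg.norm.pow 2).intervalIntegrable_of_Icc hl.le)
  rw [hint]
  refine (norm_sq_le_integral_norm_sq_add_integral_norm_deriv_sq hδ (hf.continuousOn.mono hsub)
    (hf'.mono hsub) fun x hx ↦ hderiv x ⟨hx.1, hx.2.trans_le hδl⟩).trans ?_
  gcongr ?_ * ?_ + ?_ * ?_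
  · exact extend hf.continuousOn
  · exact extend hf'
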